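/- Let m ≥ 1 be an integer, A a commutative ring, and g a function assigning to each subset of {1,…,m} an element of A. Then Σ_{π ∈ P([m])} (−1)^{#π−1}·(#π−1)!·(Σ_{B∈π} g(B)) = Σ_{∅ ≠ C ⊆ [m]} (−1)^{m−|C|}·g(C), where P([m]) is the set of all set partitions of {1,…,m} into nonempty blocks, the inner sum on the left runs over the blocks B of π, and the sum on the right runs over all nonempty subsets C of {1,…,m}. -/

import Mathlib

/-- The set of all set partitions of a finite set `s` into nonempty blocks. -/
def partitionsOf {α : Type*} [DecidableEq α] (s : Finset α) : Finset (Finset (Finset α)) :=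
  s.powerset.powerset.filter
    (fun π => (∀ B ∈ π, B ≠ ∅) ∧ (∀ B ∈ π, ∀ B' ∈ π, B ≠ B' → B ∩ B' = ∅) ∧
      π.sup id = s)

theorem mem_partitionsOf {α : Type*} [DecidableEq α] {s : Finset α} {π : Finset (Finset α)} :
    π ∈ partitionsOf s ↔ (∀ B ∈ π, B.Nonempty) ∧
      (∀ B ∈ π, ∀ B' ∈ π, ∀ x ∈ B, x ∈ B' → B = B') ∧ ∀ x, x ∈ s ↔ ∃ B ∈ π, x ∈ B := by
  have hsup : π.sup id = s ↔ ∀ x, x ∈ s ↔ ∃ B ∈ π, x ∈ B := by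
    simp [Finset.ext_iff, Finset.mem_sup, iff_comm]
  have hdisj : (∀ B ∈ π, ∀ B' ∈ π, B ≠ B' → B ∩ B' = ∅) ↔
      ∀ B ∈ π, ∀ B' ∈ π, ∀ x ∈ B, x ∈ B' → B = B' := by
    simp only [Finset.ext_iff (s₂ := ∅), Finset.mem_inter, Finset.notMem_empty]
    grind
  simp only [partitionsOf, Finset.mem_filter, Finset.mem_powerset, hsup, hdisj,
    Finset.nonempty_iff_ne_empty]
  refine and_iff_right_of_imp fun h B hB => ?_
  exact Finset.mem_powerset.2 fun x hx => (h.2.2 x).2 ⟨B, hB, hx⟩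

theorem erase_mem_partitionsOf {α : Type*} [DecidableEq α] {s B : Finset α}
    {π : Finset (Finset α)} (hπ : π ∈ partitionsOf s) (hB : B ∈ π) :
    π.erase B ∈ partitionsOf (s \ B) := by
  rw [mem_partitionsOf] at hπ ⊢
  obtain ⟨h1, h2, h3⟩ := hπ
  refine ⟨fun C hC => h1 C (Finset.mem_of_mem_erase hC), fun C hC D hD =>
    h2 C (Finset.mem_of_mem_erase hC) D (Finset.mem_of_mem_erase hD), fun x => ?_⟩
  rw [Finset.mem_sdiff, h3]
  constructor
  · rintro ⟨⟨C, hC, hx⟩, hxB⟩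
    exact ⟨C, Finset.mem_erase.2 ⟨fun h => hxB (h ▸ hx), hC⟩, hx⟩
  · rintro ⟨C, hC, hx⟩
    obtain ⟨hne, hC⟩ := Finset.mem_erase.1 hC
    exact ⟨⟨C, hC, hx⟩, fun hxB => hne (h2 C hC B hB x hx hxB)⟩

theorem notMem_of_mem_partitionsOf_sdiff {α : Type*} [DecidableEq α] {s B : Finset α}
    {τ : Finset (Finset α)} (hB : B.Nonempty) (hτ : τ ∈ partitionsOf (s \ B)) : B ∉ τ := by
  obtain ⟨x, hx⟩ := hB
  intro h
  exact (Finset.mem_sdiff.1 (((mem_partitionsOf.1 hτ).2.2 x).2 ⟨B, h, hx⟩)).2 hx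

theorem insert_mem_partitionsOf {α : Type*} [DecidableEq α] {s B : Finset α}
    {τ : Finset (Finset α)} (hBs : B ⊆ s) (hB : B.Nonempty) (hτ : τ ∈ partitionsOf (s \ B)) :
    insert B τ ∈ partitionsOf s := by
  rw [mem_partitionsOf] at hτ ⊢
  obtain ⟨h1, h2, h3⟩ := hτ
  have h4 : ∀ C ∈ τ, ∀ x ∈ C, x ∉ B := fun C hC x hx =>
    (Finset.mem_sdiff.1 ((h3 x).2 ⟨C, hC, hx⟩)).2
  refine ⟨by grind, by grind, fun x => ?_⟩
  have := h3 x
  rw [Finset.mem_sdiff] at this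
  rw [Finset.exists_mem_insert, ← this]
  have := @hBs x
  tauto

/-- Choosing a partition of `s` and one of its blocks amounts to choosing a nonempty subset `B`
of `s` and a partition of `s \ B`. -/
theorem sum_partitionsOf_sum_mem {α M : Type*} [DecidableEq α] [AddCommMonoid M] (s : Finset α)
    (f : Finset (Finset α) → Finset α → M) :
    ∑ π ∈ partitionsOf s, ∑ B ∈ π, f π B =
      ∑ B ∈ s.powerset with B.Nonempty, ∑ τ ∈ partitionsOf (s \ B), f (insert B τ) B := by
  rw [Finset.sum_sigma', Finset.sum_sigma']
  refine Finset.sum_bij' (fun p _ => ⟨p.2, p.1.erase p.2⟩) (fun q _ => ⟨insert q.1 q.2, q.1⟩)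
    ?_ ?_ ?_ ?_ ?_
  · rintro ⟨π, B⟩ h
    obtain ⟨hπ, hB⟩ := Finset.mem_sigma.1 h
    have hπ' := mem_partitionsOf.1 hπ
    exact Finset.mem_sigma.2 ⟨Finset.mem_filter.2 ⟨Finset.mem_powerset.2 fun x hx =>
      (hπ'.2.2 x).2 ⟨B, hB, hx⟩, hπ'.1 B hB⟩, erase_mem_partitionsOf hπ hB⟩
  · rintro ⟨B, τ⟩ h
    obtain ⟨hB, hτ⟩ := Finset.mem_sigma.1 h
    obtain ⟨hBs, hB⟩ := Finset.mem_filter.1 hB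
    exact Finset.mem_sigma.2 ⟨insert_mem_partitionsOf (Finset.mem_powerset.1 hBs) hB hτ,
      Finset.mem_insert_self _ _⟩
  · rintro ⟨π, B⟩ h
    simp [Finset.insert_erase (Finset.mem_sigma.1 h).2]
  · rintro ⟨B, τ⟩ h
    obtain ⟨hB, hτ⟩ := Finset.mem_sigma.1 h
    simp [Finset.erase_insert
      (notMem_of_mem_partitionsOf_sdiff (Finset.mem_filter.1 hB).2 hτ)]
  · rintro ⟨π, B⟩ h
    simp [Finset.insert_erase (Finset.mem_sigma.1 h).2]

theorem partitionsOf_empty {α : Type*} [DecidableEq α] : partitionsOf (∅ : Finset α) = {∅} := by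
  ext π
  rw [mem_partitionsOf, Finset.mem_singleton]
  constructor
  · rintro ⟨h1, -, h3⟩
    refine Finset.eq_empty_of_forall_notMem fun B hB => ?_
    obtain ⟨x, hx⟩ := h1 B hB
    exact Finset.notMem_empty x ((h3 x).2 ⟨B, hB, hx⟩)
  · rintro rfl
    simp

theorem sum_partitionsOf_neg_one_pow_mul_factorial {α : Type*} [DecidableEq α] (s : Finset α) :
    ∑ π ∈ partitionsOf s, (-1 : ℤ) ^ π.card * π.card.factorial = (-1) ^ s.card := by
  induction s using Finset.strongInduction with
  | H s ih =>
    rcases s.eq_empty_or_nonempty with rfl | hs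
    · simp [partitionsOf_empty]
    have hblock : ∀ π ∈ partitionsOf s, (-1 : ℤ) ^ π.card * π.card.factorial =
        ∑ _B ∈ π, (-1 : ℤ) ^ π.card * (π.card - 1).factorial := by
      intro π hπ
      obtain ⟨x, hx⟩ := hs
      obtain ⟨B, hB, -⟩ := ((mem_partitionsOf.1 hπ).2.2 x).1 hx
      rw [Finset.sum_const, nsmul_eq_mul,
        ← Nat.mul_factorial_pred (Finset.card_ne_zero_of_mem hB)]
      push_cast
      ring
    have hcompl : ∀ B ∈ s.powerset.filter (·.Nonempty),
        ∑ τ ∈ partitionsOf (s \ B), (-1 : ℤ) ^ (insert B τ).card *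
          ((insert B τ).card - 1).factorial = -((-1) ^ s.card * (-1) ^ B.card) := by
      intro B hB
      obtain ⟨hBs, hB⟩ := Finset.mem_filter.1 hB
      rw [Finset.mem_powerset] at hBs
      have hpow : (-1 : ℤ) ^ s.card * (-1) ^ B.card = (-1) ^ (s \ B).card := by
        rw [← Finset.card_sdiff_add_card_eq_card hBs, pow_add, mul_assoc, ← mul_pow]
        simp
      rw [hpow, ← ih _ (Finset.sdiff_ssubset hBs hB), ← Finset.sum_neg_distrib]
      refine Finset.sum_congr rfl fun τ hτ => ?_
      rw [Finset.card_insert_of_notMem (notMem_of_mem_partitionsOf_sdiff hB hτ),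
        Nat.add_sub_cancel, pow_succ]
      ring
    have halt : ∑ B ∈ s.powerset with B.Nonempty, (-1 : ℤ) ^ B.card = -1 := by
      have h := Finset.sum_powerset_neg_one_pow_card_of_nonempty hs
      rw [← Finset.sum_filter_add_sum_filter_not _ (fun B : Finset α => B.Nonempty)] at h
      have hempty : s.powerset.filter (fun B => ¬ B.Nonempty) = {∅} := by
        ext B
        simp only [Finset.mem_filter, Finset.mem_powerset, Finset.not_nonempty_iff_eq_empty,
          Finset.mem_singleton]
        exact and_iff_right_of_imp fun h => h ▸ Finset.empty_subset s
      rw [hempty, Finset.sum_singleton, Finset.card_empty, pow_zero] at h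
      linarith
    rw [Finset.sum_congr rfl hblock, sum_partitionsOf_sum_mem, Finset.sum_congr rfl hcompl,
      Finset.sum_neg_distrib, ← Finset.mul_sum, halt]
    ring

/-- for a commutative ring `A` and `g : subsets of [m] → A`,
`Σ_{π ∈ P([m])} (−1)^{#π−1}(#π−1)!·(Σ_{B∈π} g(B)) = Σ_{∅≠C⊆[m]} (−1)^{m−|C|}·g(C)`. -/
theorem partition_sum_eq_subset_sum (m : ℕ) (hm : 1 ≤ m) {A : Type*} [CommRing A]
    (g : Finset (Fin m) → A) :
    ∑ π ∈ partitionsOf (Finset.univ : Finset (Fin m)),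
      ((-1 : ℤ) ^ (π.card - 1) * (π.card - 1).factorial) • (∑ B ∈ π, g B)
    = ∑ C ∈ (Finset.univ : Finset (Fin m)).powerset.filter (fun C => C.Nonempty),
        ((-1 : ℤ) ^ (m - C.card)) • g C := by
  simp only [Finset.smul_sum]
  rw [sum_partitionsOf_sum_mem]
  refine Finset.sum_congr rfl fun C hC => ?_
  have hC := (Finset.mem_filter.1 hC).2
  have hcard : (Finset.univ \ C).card = m - C.card := by
    rw [Finset.card_univ_sdiff, Fintype.card_fin]
  rw [← hcard, ← sum_partitionsOf_neg_one_pow_mul_factorial, Finset.sum_smul]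
  refine Finset.sum_congr rfl fun τ hτ => ?_
  rw [Finset.card_insert_of_notMem (notMem_of_mem_partitionsOf_sdiff hC hτ), Nat.add_sub_cancel]
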